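/- Fix an integer n ≥ 1. For 0 < α < 1 and β > 0, the Meixner polynomial M_n^{(α,β)} has n distinct real zeros x_1(α,β) < ⋯ < x_n(α,β) in (0, ∞), and for each j ∈ {1,...,n} the zero x_j(α,β) is a strictly increasing function of α on (0, 1) and a strictly increasing function of β on (0, ∞). -/

import Mathlib

/-- Pochhammer symbol `(a)_k = ∏_{j=0}^{k-1} (a + j)`. -/
noncomputable def poch (a : ℝ) (k : ℕ) : ℝ := ∏ j ∈ Finset.range k, (a + (j : ℝ))

/-- Meixner polynomial `M_n^{(α,β)}(x)`. -/
noncomputable def meixnerPoly (n : ℕ) (α β x : ℝ) : ℝ :=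
  ∑ k ∈ Finset.range (n + 1),
    poch (-(n : ℝ)) k * poch (-x) k / (poch β k * (Nat.factorial k : ℝ)) * (1 - 1 / α) ^ k

section LatticeWeights

open Polynomial

/-- The functional `p ↦ ∑_{k ∈ ℕ} w k * p(k)` attached to a weight `w` on `ℕ`. -/
noncomputable def latticeSum (w : ℕ → ℝ) (p : ℝ[X]) : ℝ := ∑' k : ℕ, w k * p.eval (k : ℝ)

/-- A strictly positive weight on `ℕ` with finite moments of all orders. -/
structure IsLatticeWeight (w : ℕ → ℝ) : Prop where
  pos : ∀ k, 0 < w k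
  summable : ∀ p : ℝ[X], Summable fun k : ℕ => w k * p.eval (k : ℝ)

/-- `q` is orthogonal to all polynomials of degree less than `n` with respect to `w`. -/
def IsLatticeOrthogonal (w : ℕ → ℝ) (n : ℕ) (q : ℝ[X]) : Prop :=
  ∀ r : ℝ[X], r.natDegree < n → latticeSum w (q * r) = 0

namespace IsLatticeWeight

variable {w w₁ w₂ : ℕ → ℝ}

theorem latticeSum_add (hw : IsLatticeWeight w) (p q : ℝ[X]) :
    latticeSum w (p + q) = latticeSum w p + latticeSum w q := by
  unfold latticeSum
  rw [← (hw.summable p).tsum_add (hw.summable q)]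
  simp only [eval_add, mul_add]

theorem latticeSum_C_mul (w : ℕ → ℝ) (a : ℝ) (p : ℝ[X]) :
    latticeSum w (C a * p) = a * latticeSum w p := by
  unfold latticeSum
  rw [← tsum_mul_left]
  simp only [eval_mul, eval_C, mul_left_comm]

theorem latticeSum_sum (hw : IsLatticeWeight w) {ι : Type*} (s : Finset ι) (p : ι → ℝ[X]) :
    latticeSum w (∑ i ∈ s, p i) = ∑ i ∈ s, latticeSum w (p i) := by
  classical
  induction s using Finset.induction_on with
  | empty => simp [latticeSum]
  | insert i s hi ih => rw [Finset.sum_insert hi, Finset.sum_insert hi, hw.latticeSum_add, ih]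

theorem exists_natCast_eval_ne_zero {p : ℝ[X]} (hp : p ≠ 0) (m : ℕ) :
    ∃ k : ℕ, m < k ∧ p.eval (k : ℝ) ≠ 0 := by
  by_contra! h
  refine hp (eq_zero_of_infinite_isRoot p ?_)
  refine ((Set.Ioi_infinite m).image Nat.cast_injective.injOn).mono ?_
  rintro _ ⟨k, hk, rfl⟩
  exact h k hk

theorem latticeSum_nonneg (hw : IsLatticeWeight w) {p : ℝ[X]}
    (h : ∀ k : ℕ, 0 ≤ p.eval (k : ℝ)) : 0 ≤ latticeSum w p :=
  tsum_nonneg fun k => mul_nonneg (hw.pos k).le (h k)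

theorem latticeSum_pos (hw : IsLatticeWeight w) {p : ℝ[X]} (hp : p ≠ 0)
    (h : ∀ k : ℕ, 0 ≤ p.eval (k : ℝ)) : 0 < latticeSum w p := by
  obtain ⟨k, -, hk⟩ := exists_natCast_eval_ne_zero hp 0
  exact (hw.summable p).tsum_pos (fun k => mul_nonneg (hw.pos k).le (h k)) k
    (mul_pos (hw.pos k) ((h k).lt_of_ne' hk))

/-- Positivity of Gauss quadrature, without the explicit quadrature weights. -/
theorem latticeSum_nonneg_of_eval_nodes_nonneg (hw : IsLatticeWeight w) {n : ℕ}
    {x : Fin n → ℝ} (hx : Function.Injective x)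
    (ho : IsLatticeOrthogonal w n (Lagrange.nodal Finset.univ x)) {s : ℝ[X]}
    (hs : s.natDegree < 2 * n) (h : ∀ i, 0 ≤ s.eval (x i)) : 0 ≤ latticeSum w s := by
  set l : Fin n → ℝ[X] := Lagrange.basis Finset.univ x with hl
  set t : ℝ[X] := ∑ i, C (s.eval (x i)) * (l i) ^ 2 with ht
  have hdvd : Lagrange.nodal Finset.univ x ∣ s - t := by
    rw [Lagrange.nodal_eq]
    refine Finset.prod_dvd_of_coprime
      (fun i _ j _ hij => pairwise_coprime_X_sub_C hx hij) fun i _ => ?_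
    rw [dvd_iff_isRoot, IsRoot.def, eval_sub, ht, eval_finsetSum,
      Finset.sum_eq_single i]
    · simp [hl, Lagrange.eval_basis_self hx.injOn (Finset.mem_univ i)]
    · intro j _ hj
      simp [hl, Lagrange.eval_basis_of_ne hj (Finset.mem_univ i)]
    · simp
  obtain ⟨r, hr⟩ := hdvd
  have htdeg : t.natDegree < 2 * n := by
    refine lt_of_le_of_lt (natDegree_sum_le_of_forall_le (n := 2 * (n - 1)) _ _ fun i _ => ?_)
      (by omega)
    refine (natDegree_C_mul_le _ _).trans (natDegree_pow_le.trans ?_)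
    rw [hl, Lagrange.natDegree_basis hx.injOn (Finset.mem_univ i)]
    simp
  have hrdeg : r.natDegree < n := by
    by_cases hr0 : r = 0
    · subst hr0; simp; omega
    have h1 : (s - t).natDegree < 2 * n :=
      (natDegree_sub_le _ _).trans_lt (max_lt hs htdeg)
    rw [hr, natDegree_mul Lagrange.nodal_ne_zero hr0, Lagrange.natDegree_nodal] at h1
    simp at h1
    omega
  have hst : s = Lagrange.nodal Finset.univ x * r + t := by rw [← hr]; ring
  rw [hst, hw.latticeSum_add, ho r hrdeg, zero_add, ht, hw.latticeSum_sum]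
  refine Finset.sum_nonneg fun i _ => ?_
  rw [latticeSum_C_mul]
  refine mul_nonneg (h i) (hw.latticeSum_nonneg fun k => ?_)
  rw [eval_pow]
  positivity

/-- Markov's comparison principle: zeros of orthogonal polynomials move to the right when the
weight is multiplied by a strictly increasing function. -/
theorem zero_lt_zero_of_ratio_strictMono (hw₁ : IsLatticeWeight w₁) (hw₂ : IsLatticeWeight w₂)
    (hr : StrictMono fun k => w₂ k / w₁ k) {n : ℕ} {x y : Fin n → ℝ}
    (hx : StrictMono x) (hy : StrictMono y)
    (hox : IsLatticeOrthogonal w₁ n (Lagrange.nodal Finset.univ x))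
    (hoy : IsLatticeOrthogonal w₂ n (Lagrange.nodal Finset.univ y))
    (j : Fin n) : x j < y j := by
  by_contra! hle
  set t : ℝ[X] := ∏ i ∈ Finset.univ.erase j, (X - C (if i < j then x i else y i)) with ht
  set s : ℝ[X] := (X - C (y j)) * t ^ 2 with hs
  have hs0 : s ≠ 0 := mul_ne_zero (X_sub_C_ne_zero _)
    (pow_ne_zero _ (Finset.prod_ne_zero_iff.2 fun i _ => X_sub_C_ne_zero _))
  have hsdeg : s.natDegree < 2 * n := by
    have h1 : t.natDegree = n - 1 := by
      rw [ht, natDegree_finsetProd_X_sub_C_eq_card]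
      simp
    have h2 : s.natDegree ≤ 1 + 2 * (n - 1) := by
      refine natDegree_mul_le.trans (add_le_add (natDegree_X_sub_C_le _) ?_)
      exact natDegree_pow_le.trans (by rw [h1])
    have := j.pos
    omega
  have heval : ∀ u, s.eval u = (u - y j) * (t.eval u) ^ 2 := fun u => by simp [hs]
  have ht0 : ∀ i, i ≠ j → ∀ u, u = (if i < j then x i else y i) → t.eval u = 0 := by
    intro i hi u hu
    rw [ht, eval_prod]
    exact Finset.prod_eq_zero (Finset.mem_erase.2 ⟨hi, Finset.mem_univ i⟩) (by simp [hu])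
  have hS₁ : 0 ≤ latticeSum w₁ s := by
    refine hw₁.latticeSum_nonneg_of_eval_nodes_nonneg hx.injective hox hsdeg fun i => ?_
    rw [heval]
    rcases lt_or_ge i j with hij | hij
    · rw [ht0 i hij.ne (x i) (by rw [if_pos hij])]; simp
    · exact mul_nonneg (sub_nonneg.2 (hle.trans (hx.monotone hij))) (sq_nonneg _)
  have hS₂ : 0 ≤ latticeSum w₂ (C (-1) * s) := by
    refine hw₂.latticeSum_nonneg_of_eval_nodes_nonneg hy.injective hoy
      ((natDegree_C_mul_le _ _).trans_lt hsdeg) fun i => ?_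
    rw [eval_mul, eval_C, heval]
    rcases lt_or_ge j i with hij | hij
    · rw [ht0 i hij.ne' (y i) (by rw [if_neg hij.not_gt])]; simp
    · have : y i - y j ≤ 0 := sub_nonpos.2 (hy.monotone hij)
      nlinarith [mul_nonneg (neg_nonneg.2 this) (sq_nonneg (t.eval (y i)))]
  rw [latticeSum_C_mul] at hS₂
  set m := ⌈y j⌉₊ with hm
  set c := w₂ m / w₁ m with hc
  have hc0 : 0 < c := div_pos (hw₂.pos m) (hw₁.pos m)
  have hterm : ∀ k : ℕ, w₂ k * s.eval (k : ℝ) - c * (w₁ k * s.eval (k : ℝ))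
      = w₁ k * ((w₂ k / w₁ k - c) * ((k : ℝ) - y j)) * (t.eval (k : ℝ)) ^ 2 := fun k => by
    rw [heval]
    field_simp [(hw₁.pos k).ne']
  have hnn : ∀ k : ℕ, 0 ≤ (w₂ k / w₁ k - c) * ((k : ℝ) - y j) := fun k => by
    rcases lt_or_ge k m with hk | hk
    · exact mul_nonneg_of_nonpos_of_nonpos (sub_nonpos.2 (hr hk).le)
        (sub_nonpos.2 (Nat.lt_ceil.1 hk).le)
    · exact mul_nonneg (sub_nonneg.2 (hr.monotone hk)) (sub_nonneg.2 (Nat.ceil_le.1 hk))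
  obtain ⟨k, hmk, hk⟩ := exists_natCast_eval_ne_zero hs0 m
  have hpos : 0 < ∑' k : ℕ, (w₂ k * s.eval (k : ℝ) - c * (w₁ k * s.eval (k : ℝ))) := by
    refine ((hw₂.summable s).sub ((hw₁.summable s).mul_left c)).tsum_pos (fun k => ?_) k ?_
    · rw [hterm]
      exact mul_nonneg (mul_nonneg (hw₁.pos k).le (hnn k)) (sq_nonneg _)
    · rw [heval] at hk
      rw [hterm]
      have h1 : 0 < w₂ k / w₁ k - c := sub_pos.2 (hr hmk)
      have h2 : 0 < (k : ℝ) - y j :=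
        (sub_nonneg.2 (Nat.ceil_le.1 hmk.le)).lt_of_ne' (left_ne_zero_of_mul hk)
      have h3 : 0 < (t.eval (k : ℝ)) ^ 2 :=
        (sq_nonneg _).lt_of_ne' (right_ne_zero_of_mul hk)
      exact mul_pos (mul_pos (hw₁.pos k) (mul_pos h1 h2)) h3
  rw [(hw₂.summable s).tsum_sub ((hw₁.summable s).mul_left c), tsum_mul_left] at hpos
  change 0 < latticeSum w₂ s - c * latticeSum w₁ s at hpos
  nlinarith [mul_nonneg hc0.le hS₁]

end IsLatticeWeight

/-- Some set `z` of positive roots of `p` is such that `p * ∏ (X - z)` has constant sign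
on `[0, ∞)`. -/
theorem Polynomial.exists_finset_pos_roots_mul_const_sign (p : ℝ[X]) (hp : p ≠ 0) :
    ∃ z : Finset ℝ, (∀ a ∈ z, 0 < a ∧ p.IsRoot a) ∧
      ((∀ u, 0 ≤ u → 0 ≤ (p * ∏ a ∈ z, (X - C a)).eval u) ∨
        ∀ u, 0 ≤ u → (p * ∏ a ∈ z, (X - C a)).eval u ≤ 0) := by
  induction hd : p.natDegree using Nat.strong_induction_on generalizing p with
  | _ d ih =>
  by_cases hroot : ∃ a, 0 < a ∧ p.IsRoot a
  · obtain ⟨a, ha, hpa⟩ := hroot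
    obtain ⟨q, rfl⟩ := dvd_iff_isRoot.2 hpa
    have hq : q ≠ 0 := right_ne_zero_of_mul hp
    have hdeg : q.natDegree < d := by
      rw [← hd, natDegree_mul (X_sub_C_ne_zero a) hq, natDegree_X_sub_C]
      omega
    obtain ⟨z, hz, hsign⟩ := ih _ hdeg q hq rfl
    by_cases haz : a ∈ z
    · refine ⟨z.erase a, fun b hb => ⟨(hz b (Finset.mem_of_mem_erase hb)).1, ?_⟩, ?_⟩
      · exact root_mul_left_of_isRoot _ (hz b (Finset.mem_of_mem_erase hb)).2
      · have : (X - C a) * q * ∏ b ∈ z.erase a, (X - C b) = q * ∏ b ∈ z, (X - C b) := by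
          rw [← Finset.mul_prod_erase z _ haz]; ring
        rwa [this]
    · refine ⟨insert a z, fun b hb => ?_, ?_⟩
      · rcases Finset.mem_insert.1 hb with rfl | hb
        · exact ⟨ha, hpa⟩
        · exact ⟨(hz b hb).1, root_mul_left_of_isRoot _ (hz b hb).2⟩
      · have : (X - C a) * q * ∏ b ∈ insert a z, (X - C b)
            = (X - C a) ^ 2 * (q * ∏ b ∈ z, (X - C b)) := by
          rw [Finset.prod_insert haz]; ring
        simp only [this, eval_mul (p := (X - C a) ^ 2), eval_pow]
        exact hsign.imp (fun h u hu => mul_nonneg (sq_nonneg _) (h u hu))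
          fun h u hu => mul_nonpos_of_nonneg_of_nonpos (sq_nonneg _) (h u hu)
  · refine ⟨∅, by simp, ?_⟩
    rw [Finset.prod_empty, mul_one]
    by_contra! h
    obtain ⟨⟨u, hu, hpu⟩, v, hv, hpv⟩ := h
    have hsub := intermediate_value_uIcc (a := u) (b := v) p.continuous.continuousOn
    obtain ⟨a, ha, hpa⟩ := hsub (Set.mem_uIcc.2 (Or.inl ⟨hpu.le, hpv.le⟩))
    refine hroot ⟨a, ?_, hpa⟩
    have ha0 : 0 ≤ a := (le_min hu hv).trans ha.1
    refine ha0.lt_of_ne ?_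
    rintro rfl
    rcases min_le_iff.1 ha.1 with h | h
    · obtain rfl : u = 0 := le_antisymm h hu
      exact hpu.ne hpa
    · obtain rfl : v = 0 := le_antisymm h hv
      exact hpv.ne' hpa

/-- A nonzero polynomial of degree at most `n` which is orthogonal to all polynomials of lower
degree has `n` distinct positive zeros. -/
theorem IsLatticeWeight.exists_zeros {w : ℕ → ℝ} (hw : IsLatticeWeight w) {n : ℕ} {q : ℝ[X]}
    (hq : q ≠ 0) (hdeg : q.natDegree ≤ n) (ho : IsLatticeOrthogonal w n q) :
    ∃ x : Fin n → ℝ, StrictMono x ∧ (∀ j, 0 < x j) ∧ (∀ u, q.eval u = 0 ↔ ∃ j, u = x j) ∧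
      IsLatticeOrthogonal w n (Lagrange.nodal Finset.univ x) := by
  obtain ⟨z, hz, hsign⟩ := q.exists_finset_pos_roots_mul_const_sign hq
  have hsub : z.val ⊆ q.roots := fun a ha => (mem_roots hq).2 (hz a ha).2
  have hzdeg : z.card ≤ q.natDegree := card_le_degree_of_subset_roots hsub
  have hprod : (∏ a ∈ z, (X - C a)).natDegree = z.card :=
    natDegree_finsetProd_X_sub_C_eq_card z fun a => a
  have hcard : n ≤ z.card := by
    by_contra! hlt
    set t : ℝ[X] := ∏ a ∈ z, (X - C a) with ht
    have htdeg : t.natDegree < n := by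
      rwa [ht, hprod]
    have hqt : q * t ≠ 0 :=
      mul_ne_zero hq (Finset.prod_ne_zero_iff.2 fun i _ => X_sub_C_ne_zero _)
    have h0 := ho t htdeg
    rcases hsign with h | h
    · exact (hw.latticeSum_pos hqt fun k => h k k.cast_nonneg).ne' h0
    · have := hw.latticeSum_pos (p := C (-1) * (q * t))
        (mul_ne_zero (by simp) hqt) fun k => by
          have := h k k.cast_nonneg
          rw [eval_mul, eval_C]
          linarith
      rw [latticeSum_C_mul, h0] at this
      simp at this
  have hzn : z.card = n := le_antisymm (hzdeg.trans hdeg) hcard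
  have hnodal : Lagrange.nodal Finset.univ (z.orderEmbOfFin hzn) = ∏ a ∈ z, (X - C a) := by
    rw [Lagrange.nodal_eq]
    conv_rhs => rw [← Finset.image_orderEmbOfFin_univ z hzn]
    rw [Finset.prod_image fun i _ j _ h => (z.orderEmbOfFin hzn).injective h]
  have hdvd : (∏ a ∈ z, (X - C a)) ∣ q :=
    Finset.prod_dvd_of_coprime
      (fun i _ j _ hij => pairwise_coprime_X_sub_C (s := id) Function.injective_id hij)
      fun a ha => dvd_iff_isRoot.2 (hz a ha).2
  obtain ⟨r, hr⟩ := hdvd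
  have hr0 : r ≠ 0 := by rintro rfl; simp [hr] at hq
  have hrdeg : r.natDegree = 0 := by
    have h1 := hdeg
    rw [hr, natDegree_mul (left_ne_zero_of_mul (hr ▸ hq)) hr0, hprod] at h1
    omega
  obtain ⟨c, rfl⟩ := natDegree_eq_zero.1 hrdeg
  have hc : c ≠ 0 := by rintro rfl; simp at hr0
  refine ⟨z.orderEmbOfFin hzn, (z.orderEmbOfFin hzn).strictMono,
    fun j => (hz _ (z.orderEmbOfFin_mem hzn j)).1, fun u => ?_, fun p hp => ?_⟩
  · rw [hr, ← hnodal, eval_mul, eval_C, mul_eq_zero, or_iff_left hc, Lagrange.eval_nodal,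
      Finset.prod_eq_zero_iff]
    simp [sub_eq_zero]
  · have h0 := ho p hp
    rw [hr, ← hnodal, mul_right_comm, mul_comm, latticeSum_C_mul] at h0
    exact (mul_eq_zero.1 h0).resolve_left hc

end LatticeWeights

section Meixner

open Polynomial

theorem poch_succ (a : ℝ) (k : ℕ) : poch a (k + 1) = poch a k * (a + k) :=
  Finset.prod_range_succ _ _

theorem poch_succ' (a : ℝ) (k : ℕ) : poch a (k + 1) = a * poch (a + 1) k := by
  unfold poch
  rw [Finset.prod_range_succ', mul_comm]
  simp [add_assoc, add_comm (1 : ℝ)]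

theorem poch_add (a : ℝ) (k m : ℕ) : poch a (k + m) = poch a k * poch (a + k) m := by
  unfold poch
  rw [Finset.prod_range_add]
  simp [add_assoc]

theorem poch_pos {a : ℝ} (ha : 0 < a) (k : ℕ) : 0 < poch a k :=
  Finset.prod_pos fun _ _ => by positivity

theorem poch_neg_natCast {n k : ℕ} (hk : k ≤ n) :
    poch (-(n : ℝ)) k = (-1) ^ k * n.choose k * k.factorial := by
  induction k with
  | zero => simp [poch]
  | succ k ih =>
    have h : (n.choose (k + 1) : ℝ) * (k + 1) = n.choose k * (n - k) := by
      have := Nat.choose_succ_right_eq n k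
      rw [← Nat.cast_sub (by omega : k ≤ n)]
      exact_mod_cast this
    rw [poch_succ, ih (by omega), Nat.factorial_succ]
    push_cast
    linear_combination (-1 : ℝ) ^ k * k.factorial * h

/-- The weight `c ^ k (a)_k / k!` on `ℕ`. -/
noncomputable def meixnerWeight (c a : ℝ) (k : ℕ) : ℝ := c ^ k * poch a k / k.factorial

theorem meixnerWeight_pos {c a : ℝ} (hc : 0 < c) (ha : 0 < a) (k : ℕ) :
    0 < meixnerWeight c a k := by
  have := poch_pos ha k
  unfold meixnerWeight
  positivity

theorem meixnerWeight_mul_add (c a : ℝ) (k : ℕ) :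
    meixnerWeight c a k * (k + a) = a * meixnerWeight c (a + 1) k := by
  have h : poch a k * (a + k) = a * poch (a + 1) k := by rw [← poch_succ, poch_succ']
  unfold meixnerWeight
  linear_combination c ^ k / k.factorial * h

theorem meixnerWeight_succ (c a : ℝ) (k : ℕ) :
    meixnerWeight c a (k + 1) * (k + 1) = c * a * meixnerWeight c (a + 1) k := by
  unfold meixnerWeight
  rw [poch_succ', Nat.factorial_succ]
  push_cast
  field_simp
  ring

theorem meixnerWeight_succ_mul (c a : ℝ) (k : ℕ) :
    meixnerWeight c a (k + 1) * (k + 1) = meixnerWeight c a k * (c * (a + k)) := by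
  unfold meixnerWeight
  rw [poch_succ, Nat.factorial_succ]
  push_cast
  field_simp
  ring

theorem summable_meixnerWeight {c a : ℝ} (hc : 0 < c) (hc1 : c < 1) (ha : 0 < a) :
    Summable (meixnerWeight c a) := by
  refine summable_of_ratio_test_tendsto_lt_one hc1
    (Filter.Eventually.of_forall fun k => (meixnerWeight_pos hc ha k).ne') ?_
  have h : ∀ k : ℕ, ‖meixnerWeight c a (k + 1)‖ / ‖meixnerWeight c a k‖
      = c + c * (a - 1) * (1 / ((k : ℝ) + 1)) := fun k => by
    have h0 := meixnerWeight_pos hc ha k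
    rw [Real.norm_of_nonneg (meixnerWeight_pos hc ha _).le, Real.norm_of_nonneg h0.le,
      div_eq_iff h0.ne']
    have hk : (k : ℝ) + 1 ≠ 0 := by positivity
    apply mul_right_cancel₀ hk
    rw [meixnerWeight_succ_mul]
    field_simp
    ring
  simp only [h]
  simpa using
    (tendsto_one_div_add_atTop_nhds_zero_nat (𝕜 := ℝ)).const_mul (c * (a - 1)) |>.const_add c

theorem Polynomial.eq_C_eval_add_X_add_C_mul (p : ℝ[X]) (a : ℝ) :
    ∃ q : ℝ[X], p = C (p.eval (-a)) + (X + C a) * q ∧ q.natDegree = p.natDegree - 1 := by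
  refine ⟨p /ₘ (X - C (-a)), ?_, ?_⟩
  · have := modByMonic_add_div p (X - C (-a))
    rw [modByMonic_X_sub_C_eq_C_eval] at this
    simpa using this.symm
  · rw [natDegree_divByMonic _ (monic_X_sub_C _), natDegree_X_sub_C]

theorem isLatticeWeight_meixnerWeight {c a : ℝ} (hc : 0 < c) (hc1 : c < 1) (ha : 0 < a) :
    IsLatticeWeight (meixnerWeight c a) := by
  refine ⟨meixnerWeight_pos hc ha, fun p => ?_⟩
  have hconst : ∀ b : ℝ, ∀ a : ℝ, 0 < a → Summable fun k => meixnerWeight c a k * b :=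
    fun b a ha => (summable_meixnerWeight hc hc1 ha).mul_right b
  induction hd : p.natDegree generalizing p a with
  | zero =>
    obtain ⟨b, rfl⟩ := natDegree_eq_zero.1 hd
    simpa using hconst b a ha
  | succ d ih =>
    obtain ⟨q, hp, hq⟩ := p.eq_C_eval_add_X_add_C_mul a
    have h := (hconst (p.eval (-a)) a ha).add
      ((ih (a := a + 1) (by positivity) q (by omega)).mul_left a)
    refine h.congr fun k => ?_
    conv_rhs => rw [hp]
    simp only [eval_add, eval_mul, eval_C, eval_X]
    linear_combination -(q.eval (k : ℝ)) * meixnerWeight_mul_add c a k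

theorem latticeSum_X_add_C_mul (c a : ℝ) (p : ℝ[X]) :
    latticeSum (meixnerWeight c a) ((X + C a) * p)
      = a * latticeSum (meixnerWeight c (a + 1)) p := by
  unfold latticeSum
  rw [← tsum_mul_left]
  refine tsum_congr fun k => ?_
  simp only [eval_add, eval_mul, eval_C, eval_X]
  linear_combination (p.eval (k : ℝ)) * meixnerWeight_mul_add c a k

theorem latticeSum_eq_of_eval_succ {c a : ℝ} (hc : 0 < c) (hc1 : c < 1) (ha : 0 < a)
    {p q : ℝ[X]} (h0 : p.eval 0 = 0)
    (h : ∀ k : ℕ, p.eval ((k : ℝ) + 1) = ((k : ℝ) + 1) * q.eval (k : ℝ)) :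
    latticeSum (meixnerWeight c a) p = c * a * latticeSum (meixnerWeight c (a + 1)) q := by
  unfold latticeSum
  rw [((isLatticeWeight_meixnerWeight hc hc1 ha).summable p).tsum_eq_zero_add, ← tsum_mul_left]
  simp only [Nat.cast_zero, h0, mul_zero, zero_add]
  refine tsum_congr fun k => ?_
  push_cast
  rw [h]
  linear_combination (q.eval (k : ℝ)) * meixnerWeight_succ c a k

theorem latticeSum_one_shift {c a : ℝ} (hc : 0 < c) (hc1 : c < 1) (ha : 0 < a) :
    (1 - c) * latticeSum (meixnerWeight c (a + 1)) 1 = latticeSum (meixnerWeight c a) 1 := by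
  have h1 := latticeSum_X_add_C_mul c a 1
  have h2 := latticeSum_eq_of_eval_succ hc hc1 ha (p := X) (q := 1) (by simp) (by simp)
  have hadd := (isLatticeWeight_meixnerWeight hc hc1 ha).latticeSum_add X (C a * 1)
  rw [IsLatticeWeight.latticeSum_C_mul, h2] at hadd
  rw [mul_one, ← mul_one (C a), hadd] at h1
  apply mul_left_cancel₀ ha.ne'
  linear_combination -h1

/-- The polynomial `x ↦ (-x)_k`. -/
noncomputable def pochNeg (k : ℕ) : ℝ[X] := ∏ j ∈ Finset.range k, (-X + C (j : ℝ))

theorem eval_pochNeg (k : ℕ) (u : ℝ) : (pochNeg k).eval u = poch (-u) k := by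
  simp [pochNeg, poch, eval_prod]

theorem natDegree_pochNeg_le (k : ℕ) : (pochNeg k).natDegree ≤ k := by
  refine (natDegree_prod_le _ _).trans ((Finset.sum_le_card_nsmul _ _ 1 fun j _ => ?_).trans ?_)
  · compute_degree
  · simp

theorem latticeSum_pochNeg {c a : ℝ} (hc : 0 < c) (hc1 : c < 1) (ha : 0 < a) (k : ℕ) :
    (1 - c) ^ k * latticeSum (meixnerWeight c a) (pochNeg k)
      = (-c) ^ k * poch a k * latticeSum (meixnerWeight c a) 1 := by
  induction k generalizing a with
  | zero => simp [pochNeg, poch]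
  | succ k ih =>
    have h : latticeSum (meixnerWeight c a) (pochNeg (k + 1))
        = c * a * latticeSum (meixnerWeight c (a + 1)) (C (-1) * pochNeg k) := by
      refine latticeSum_eq_of_eval_succ hc hc1 ha ?_ fun m => ?_
      · rw [eval_pochNeg, poch_succ']; simp
      · rw [eval_mul, eval_C, eval_pochNeg, eval_pochNeg, poch_succ']
        rw [show -((m : ℝ) + 1) + 1 = -m by ring]
        ring
    rw [h, IsLatticeWeight.latticeSum_C_mul, poch_succ', ← latticeSum_one_shift hc hc1 ha]
    linear_combination (-c * a * (1 - c)) * ih (a := a + 1) (by positivity)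

/-- The Meixner polynomial as an element of `ℝ[X]`. -/
noncomputable def meixnerPolynomial (n : ℕ) (α β : ℝ) : ℝ[X] :=
  ∑ k ∈ Finset.range (n + 1),
    C (poch (-(n : ℝ)) k / (poch β k * (Nat.factorial k : ℝ)) * (1 - 1 / α) ^ k) * pochNeg k

theorem eval_meixnerPolynomial (n : ℕ) (α β u : ℝ) :
    (meixnerPolynomial n α β).eval u = meixnerPoly n α β u := by
  unfold meixnerPolynomial meixnerPoly
  rw [eval_finsetSum]
  refine Finset.sum_congr rfl fun k _ => ?_
  rw [eval_mul, eval_C, eval_pochNeg]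
  ring

theorem natDegree_meixnerPolynomial_le (n : ℕ) (α β : ℝ) :
    (meixnerPolynomial n α β).natDegree ≤ n :=
  natDegree_sum_le_of_forall_le _ _ fun k hk => (natDegree_C_mul_le _ _).trans
    ((natDegree_pochNeg_le k).trans (Nat.lt_succ_iff.1 (Finset.mem_range.1 hk)))

theorem meixnerPolynomial_ne_zero (n : ℕ) (α β : ℝ) : meixnerPolynomial n α β ≠ 0 := by
  intro h
  have h1 : (meixnerPolynomial n α β).eval 0 = 1 := by
    rw [eval_meixnerPolynomial, meixnerPoly, Finset.sum_range_succ']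
    have h0 : ∀ k, poch (-(0 : ℝ)) (k + 1) = 0 := fun k => by rw [poch_succ']; simp
    simp only [h0]
    simp [poch]
  simp [h] at h1

theorem sum_choose_mul_eval_eq_zero {n : ℕ} {p : ℝ[X]} (hp : p.natDegree < n) :
    ∑ k ∈ Finset.range (n + 1), (-1 : ℝ) ^ k * n.choose k * p.eval (k : ℝ) = 0 := by
  have h := congrFun (fwdDiff_iter_eq_zero_of_degree_lt hp) 0
  rw [fwdDiff_iter_eq_sum_shift] at h
  simp only [zero_add, nsmul_eq_mul, mul_one, Pi.zero_apply, zsmul_eq_mul] at h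
  push_cast at h
  rw [← mul_zero ((-1 : ℝ) ^ n), ← h, Finset.mul_sum]
  refine Finset.sum_congr rfl fun k hk => ?_
  obtain ⟨d, rfl⟩ := Nat.exists_eq_add_of_le (Nat.lt_succ_iff.1 (Finset.mem_range.1 hk))
  have hd : ((-1 : ℝ) ^ d) * (-1) ^ d = 1 := by rw [← mul_pow]; simp
  rw [Nat.add_sub_cancel_left, pow_add]
  linear_combination (-(-1 : ℝ) ^ k * (k + d).choose k * p.eval (k : ℝ)) * hd

theorem latticeSum_meixnerPolynomial {n m : ℕ} (hm : m < n) {c β : ℝ} (hc : 0 < c)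
    (hc1 : c < 1) (hβ : 0 < β) :
    latticeSum (meixnerWeight c (β + m)) (meixnerPolynomial n c β) = 0 := by
  have ha : 0 < β + m := by positivity
  set p : ℝ[X] := ∏ j ∈ Finset.range m, (X + C (β + j)) with hp
  have hpdeg : p.natDegree < n := by
    refine lt_of_le_of_lt ((natDegree_prod_le _ _).trans
      ((Finset.sum_le_card_nsmul _ _ 1 fun j _ => ?_).trans ?_)) hm
    · rw [natDegree_X_add_C]
    · simp
  have hpeval : ∀ k : ℕ, p.eval (k : ℝ) = poch (β + k) m := fun k => by
    rw [hp, eval_prod, poch]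
    refine Finset.prod_congr rfl fun j _ => ?_
    simp only [eval_add, eval_X, eval_C]
    ring
  rw [meixnerPolynomial, (isLatticeWeight_meixnerWeight hc hc1 ha).latticeSum_sum]
  rw [← mul_zero (latticeSum (meixnerWeight c (β + m)) 1 / poch β m),
    ← sum_choose_mul_eval_eq_zero hpdeg, Finset.mul_sum]
  refine Finset.sum_congr rfl fun k hk => ?_
  rw [IsLatticeWeight.latticeSum_C_mul, hpeval,
    poch_neg_natCast (Nat.lt_succ_iff.1 (Finset.mem_range.1 hk))]
  have h1 : poch β k * poch (β + k) m = poch β m * poch (β + m) k := by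
    rw [← poch_add, ← poch_add, add_comm]
  have h2 := latticeSum_pochNeg hc hc1 ha k
  have h3 : (1 - 1 / c) ^ k * (-c) ^ k = (1 - c) ^ k := by
    rw [← mul_pow]
    congr 1
    field_simp
    ring
  have h4 : (-c) ^ k ≠ 0 := pow_ne_zero _ (neg_ne_zero.2 hc.ne')
  have h5 : (1 - 1 / c) ^ k * latticeSum (meixnerWeight c (β + m)) (pochNeg k)
      = poch (β + m) k * latticeSum (meixnerWeight c (β + m)) 1 := by
    apply mul_left_cancel₀ h4
    rw [← h3] at h2
    linear_combination h2
  have hk0 := (poch_pos hβ k).ne'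
  have hm0 := (poch_pos hβ m).ne'
  have hf : (k.factorial : ℝ) ≠ 0 := by positivity
  rw [mul_assoc, h5]
  field_simp
  linear_combination -(n.choose k * latticeSum (meixnerWeight c (β + m)) 1) * h1

theorem isLatticeOrthogonal_meixnerPolynomial (n : ℕ) {c β : ℝ} (hc : 0 < c) (hc1 : c < 1)
    (hβ : 0 < β) : IsLatticeOrthogonal (meixnerWeight c β) n (meixnerPolynomial n c β) := by
  have key : ∀ d m : ℕ, m + d < n → ∀ r : ℝ[X], r.natDegree = d →
      latticeSum (meixnerWeight c (β + m)) (meixnerPolynomial n c β * r) = 0 := by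
    intro d
    induction d with
    | zero =>
      intro m hm r hr
      obtain ⟨b, rfl⟩ := natDegree_eq_zero.1 hr
      rw [mul_comm, IsLatticeWeight.latticeSum_C_mul,
        latticeSum_meixnerPolynomial (by omega) hc hc1 hβ, mul_zero]
    | succ d ih =>
      intro m hm r hr
      have ha : 0 < β + m := by positivity
      obtain ⟨q, hp, hq⟩ := r.eq_C_eval_add_X_add_C_mul (β + m)
      have h := ih (m + 1) (by omega) q (by omega)
      push_cast at h
      rw [hp, show ∀ b : ℝ[X], meixnerPolynomial n c β * (b + (X + C (β + m)) * q)
          = b * meixnerPolynomial n c β + (X + C (β + m)) * (meixnerPolynomial n c β * q) by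
          intro b; ring,
        (isLatticeWeight_meixnerWeight hc hc1 ha).latticeSum_add,
        IsLatticeWeight.latticeSum_C_mul, latticeSum_meixnerPolynomial (by omega) hc hc1 hβ,
        latticeSum_X_add_C_mul, add_assoc, h]
      simp
  intro r hr
  simpa using key r.natDegree 0 (by omega) r rfl

theorem strictMono_meixnerWeight_div_left {c₁ c₂ β : ℝ} (hc₁ : 0 < c₁) (hc : c₁ < c₂)
    (hβ : 0 < β) : StrictMono fun k => meixnerWeight c₂ β k / meixnerWeight c₁ β k := by
  have h : (fun k => meixnerWeight c₂ β k / meixnerWeight c₁ β k) = fun k => (c₂ / c₁) ^ k := by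
    funext k
    have := (poch_pos hβ k).ne'
    unfold meixnerWeight
    rw [div_pow]
    field_simp
  rw [h]
  exact pow_right_strictMono₀ ((one_lt_div hc₁).2 hc)

theorem strictMono_meixnerWeight_div_right {c β₁ β₂ : ℝ} (hc : 0 < c) (hβ₁ : 0 < β₁)
    (hβ : β₁ < β₂) : StrictMono fun k => meixnerWeight c β₂ k / meixnerWeight c β₁ k := by
  refine strictMono_nat_of_lt_succ fun k => ?_
  have h₁ := meixnerWeight_pos hc hβ₁ k
  have h₂ := meixnerWeight_pos hc (hβ₁.trans hβ) k
  have hk : (0 : ℝ) < k + 1 := by positivity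
  have e₁ := meixnerWeight_succ_mul c β₁ k
  have e₂ := meixnerWeight_succ_mul c β₂ k
  rw [div_lt_div_iff₀ h₁ (meixnerWeight_pos hc hβ₁ _)]
  refine lt_of_mul_lt_mul_right ?_ hk.le
  have := mul_pos (mul_pos h₁ h₂) (mul_pos hc (sub_pos.2 hβ))
  linear_combination this + meixnerWeight c β₂ k * e₁ - meixnerWeight c β₁ k * e₂

end Meixner

/-- zeros of Meixner polynomials: location and monotonicity in `α` and `β`. -/
theorem stmt_5 (n : ℕ) (hn : 1 ≤ n) :
    ∃ x : ℝ → ℝ → Fin n → ℝ,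
      (∀ α β : ℝ, 0 < α → α < 1 → 0 < β →
        StrictMono (x α β) ∧
        (∀ j, x α β j ∈ Set.Ioi (0 : ℝ)) ∧
        (∀ j, meixnerPoly n α β (x α β j) = 0) ∧
        (∀ y : ℝ, meixnerPoly n α β y = 0 → ∃ j, y = x α β j)) ∧
      (∀ β : ℝ, 0 < β → ∀ j, StrictMonoOn (fun α => x α β j) (Set.Ioo (0 : ℝ) 1)) ∧
      (∀ α : ℝ, 0 < α → α < 1 → ∀ j, StrictMonoOn (fun β => x α β j) (Set.Ioi 0)) := by
  have key : ∀ α β : ℝ, ∃ x : Fin n → ℝ, 0 < α → α < 1 → 0 < β →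
      StrictMono x ∧ (∀ j, 0 < x j) ∧ (∀ u, meixnerPoly n α β u = 0 ↔ ∃ j, u = x j) ∧
        IsLatticeOrthogonal (meixnerWeight α β) n (Lagrange.nodal Finset.univ x) := by
    intro α β
    by_cases h : 0 < α ∧ α < 1 ∧ 0 < β
    · obtain ⟨hα, hα1, hβ⟩ := h
      obtain ⟨x, hx⟩ := (isLatticeWeight_meixnerWeight hα hα1 hβ).exists_zeros
        (meixnerPolynomial_ne_zero n α β) (natDegree_meixnerPolynomial_le n α β)
        (isLatticeOrthogonal_meixnerPolynomial n hα hα1 hβ)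
      simp only [eval_meixnerPolynomial] at hx
      exact ⟨x, fun _ _ _ => hx⟩
    · exact ⟨0, fun h₁ h₂ h₃ => absurd ⟨h₁, h₂, h₃⟩ h⟩
  choose x hx using key
  refine ⟨x, fun α β hα hα1 hβ => ?_, fun β hβ j α₁ h₁ α₂ h₂ h => ?_,
    fun α hα hα1 j β₁ h₁ β₂ h₂ h => ?_⟩
  · obtain ⟨hmono, hpos, hroot, -⟩ := hx α β hα hα1 hβ
    exact ⟨hmono, hpos, fun j => (hroot _).2 ⟨j, rfl⟩, fun y => (hroot y).1⟩
  · obtain ⟨hmono₁, -, -, ho₁⟩ := hx α₁ β h₁.1 h₁.2 hβ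
    obtain ⟨hmono₂, -, -, ho₂⟩ := hx α₂ β h₂.1 h₂.2 hβ
    exact (isLatticeWeight_meixnerWeight h₁.1 h₁.2 hβ).zero_lt_zero_of_ratio_strictMono
      (isLatticeWeight_meixnerWeight h₂.1 h₂.2 hβ)
      (strictMono_meixnerWeight_div_left h₁.1 h hβ) hmono₁ hmono₂ ho₁ ho₂ j
  · obtain ⟨hmono₁, -, -, ho₁⟩ := hx α β₁ hα hα1 h₁
    obtain ⟨hmono₂, -, -, ho₂⟩ := hx α β₂ hα hα1 h₂
    exact (isLatticeWeight_meixnerWeight hα hα1 h₁).zero_lt_zero_of_ratio_strictMono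
      (isLatticeWeight_meixnerWeight hα hα1 h₂)
      (strictMono_meixnerWeight_div_right hα h₁ h) hmono₁ hmono₂ ho₁ ho₂ j
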